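/- Let X, Y be random variables on (Ω, F, ℙ) with values in a Polish space S, and let U be uniform on [0,1], independent of (X,Y). Then there exists a random variable Y*, measurable with respect to σ(X) ∨ σ(Y) ∨ σ(U), independent of X, distributed as Y, such that ℙ(Y ≠ Y*) = β(σ(X), σ(Y)), where β is the absolute regularity (β-mixing) coefficient between σ(X) and σ(Y). -/

import Mathlib

open MeasureTheory ProbabilityTheory

/-- The β-mixing (absolute regularity) coefficient between two sub-σ-algebras. -/
noncomputable def betaMix {Ω : Type*} [MeasurableSpace Ω] (P : Measure Ω)
    (A B : MeasurableSpace Ω) : ℝ :=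
  sSup {r : ℝ | ∃ (n m : ℕ) (As : Fin n → Set Ω) (Bs : Fin m → Set Ω),
    (∀ i, MeasurableSet[A] (As i)) ∧ (∀ j, MeasurableSet[B] (Bs j)) ∧
    Pairwise (Function.onFun Disjoint As) ∧ Pairwise (Function.onFun Disjoint Bs) ∧
    (⋃ i, As i) = Set.univ ∧ (⋃ j, Bs j) = Set.univ ∧
    r = (1 / 2) * ∑ i, ∑ j,
      |(P (As i ∩ Bs j)).toReal - (P (As i)).toReal * (P (Bs j)).toReal|}

/-- Sets which are unions of cells of a finite measurable grid `(φ, ψ)` on a product space. -/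
def IsGridSet {α β : Type*} [MeasurableSpace α] [MeasurableSpace β] (E : Set (α × β)) : Prop :=
  ∃ (n m : ℕ) (φ : α → Fin n) (ψ : β → Fin m) (I : Set (Fin n × Fin m)),
    Measurable φ ∧ Measurable ψ ∧ E = Prod.map φ ψ ⁻¹' I

lemma isSetAlgebra_isGridSet (α β : Type*) [MeasurableSpace α] [MeasurableSpace β] :
    IsSetAlgebra {E : Set (α × β) | IsGridSet E} where
  empty_mem := ⟨1, 1, fun _ => 0, fun _ => 0, ∅, measurable_const, measurable_const, by simp⟩
  compl_mem := by
    rintro _ ⟨n, m, φ, ψ, I, hφ, hψ, rfl⟩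
    exact ⟨n, m, φ, ψ, Iᶜ, hφ, hψ, rfl⟩
  union_mem := by
    rintro _ _ ⟨n, m, φ, ψ, I, hφ, hψ, rfl⟩ ⟨n', m', φ', ψ', I', hφ', hψ', rfl⟩
    refine ⟨n * n', m * m', fun x => finProdFinEquiv (φ x, φ' x),
      fun y => finProdFinEquiv (ψ y, ψ' y),
      {p | ((finProdFinEquiv.symm p.1).1, (finProdFinEquiv.symm p.2).1) ∈ I ∨
        ((finProdFinEquiv.symm p.1).2, (finProdFinEquiv.symm p.2).2) ∈ I'},
      (measurable_of_finite _).comp (hφ.prodMk hφ'),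
      (measurable_of_finite _).comp (hψ.prodMk hψ'), ?_⟩
    ext ⟨x, y⟩
    simp only [Set.mem_union, Set.mem_preimage, Prod.map_apply, Set.mem_ofPred_eq,
      Equiv.symm_apply_apply]

lemma isGridSet_prod {α β : Type*} [MeasurableSpace α] [MeasurableSpace β]
    {s : Set α} {t : Set β} (hs : MeasurableSet s) (ht : MeasurableSet t) :
    IsGridSet (s ×ˢ t) := by
  classical
  refine ⟨2, 2, fun x => if x ∈ s then 1 else 0, fun y => if y ∈ t then 1 else 0, {(1, 1)},
    Measurable.ite hs measurable_const measurable_const,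
    Measurable.ite ht measurable_const measurable_const, ?_⟩
  ext ⟨x, y⟩
  by_cases hx : x ∈ s <;> by_cases hy : y ∈ t <;> simp [hx, hy]

lemma generateFrom_isGridSet (α β : Type*) [MeasurableSpace α] [MeasurableSpace β] :
    (Prod.instMeasurableSpace : MeasurableSpace (α × β)) =
      MeasurableSpace.generateFrom {E : Set (α × β) | IsGridSet E} := by
  apply le_antisymm
  · rw [← generateFrom_prod]
    apply MeasurableSpace.generateFrom_mono
    rintro _ ⟨s, hs, t, ht, rfl⟩
    exact isGridSet_prod hs ht
  · apply MeasurableSpace.generateFrom_le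
    rintro _ ⟨n, m, φ, ψ, I, hφ, hψ, rfl⟩
    exact (hφ.prodMap hψ) (Set.toFinite I).measurableSet

open scoped symmDiff in
/-- A bound on the difference of two finite measures on grid sets extends to all measurable
sets. -/
lemma measureReal_sub_le_of_isGridSet {α β : Type*} [MeasurableSpace α] [MeasurableSpace β]
    (J Q : Measure (α × β)) [IsFiniteMeasure J] [IsFiniteMeasure Q] {b : ℝ}
    (hb : ∀ E, IsGridSet E → J.real E - Q.real E ≤ b) {C : Set (α × β)} (hC : MeasurableSet C) :
    J.real C - Q.real C ≤ b := by
  refine le_of_forall_pos_le_add fun ε hε => ?_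
  obtain ⟨E, hE, hEC⟩ := exists_measure_symmDiff_lt_of_generateFrom_isSetRing (μ := J + Q)
    (isSetAlgebra_isGridSet α β).isSetRing
    ⟨{Set.univ}, Set.countable_singleton _,
      Set.singleton_subset_iff.2 (isSetAlgebra_isGridSet α β).univ_mem, by simp⟩
    (generateFrom_isGridSet α β) hC (ε := ENNReal.ofReal ε) (by simpa using hε)
  have hEm : MeasurableSet E := by
    rw [generateFrom_isGridSet α β]
    exact MeasurableSpace.measurableSet_generateFrom hE
  have h1 : J.real (E ∆ C) + Q.real (E ∆ C) ≤ ε := by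
    rw [← measureReal_add_apply]
    exact ENNReal.toReal_le_of_le_ofReal hε.le hEC.le
  have h2 : J.real C ≤ J.real E + J.real (E ∆ C) :=
    (measureReal_mono (by intro x hx; by_cases h : x ∈ E <;> simp [Set.mem_symmDiff, h, hx])).trans
      (measureReal_union_le _ _)
  have h3 : Q.real E ≤ Q.real C + Q.real (E ∆ C) :=
    (measureReal_mono (by intro x hx; by_cases h : x ∈ C <;> simp [Set.mem_symmDiff, h, hx])).trans
      (measureReal_union_le _ _)
  have := hb E hE
  linarith

/-- If a signed weight on a finite type sums to zero, its mass on any subset is at most half of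
its total variation. -/
lemma sum_le_half_sum_abs {ι : Type*} [Fintype ι] [DecidableEq ι] (d : ι → ℝ)
    (hd : ∑ i, d i = 0) (I : Finset ι) : ∑ i ∈ I, d i ≤ (1 / 2) * ∑ i, |d i| := by
  have h1 := Finset.sum_add_sum_compl I d
  have h2 := Finset.sum_add_sum_compl I (fun i => |d i|)
  have h3 : ∑ i ∈ I, d i ≤ ∑ i ∈ I, |d i| := Finset.sum_le_sum fun i _ => le_abs_self _
  have h4 : -∑ i ∈ Iᶜ, d i ≤ ∑ i ∈ Iᶜ, |d i| := by
    rw [← Finset.sum_neg_distrib]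
    exact Finset.sum_le_sum fun i _ => neg_le_abs _
  linarith

lemma measureReal_prodMap_preimage_eq_sum {α β : Type*} [MeasurableSpace α] [MeasurableSpace β]
    (J : Measure (α × β)) [IsFiniteMeasure J] {n m : ℕ} {φ : α → Fin n} {ψ : β → Fin m}
    (hφ : Measurable φ) (hψ : Measurable ψ) (I : Finset (Fin n × Fin m)) :
    J.real (Prod.map φ ψ ⁻¹' I) = ∑ p ∈ I, J.real ((φ ⁻¹' {p.1}) ×ˢ (ψ ⁻¹' {p.2})) := by
  rw [← sum_measureReal_preimage_singleton I
    (fun p _ => (hφ.prodMap hψ) (measurableSet_singleton p))]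
  refine Finset.sum_congr rfl fun p _ => ?_
  congr 1
  ext ⟨x, y⟩
  simp [Prod.ext_iff]

lemma measureReal_sub_le_half_sum_of_grid {α β : Type*} [MeasurableSpace α] [MeasurableSpace β]
    (J Q : Measure (α × β)) [IsProbabilityMeasure J] [IsProbabilityMeasure Q] {n m : ℕ}
    {φ : α → Fin n} {ψ : β → Fin m} (hφ : Measurable φ) (hψ : Measurable ψ)
    (I : Set (Fin n × Fin m)) :
    J.real (Prod.map φ ψ ⁻¹' I) - Q.real (Prod.map φ ψ ⁻¹' I) ≤
      (1 / 2) * ∑ i, ∑ j, |J.real ((φ ⁻¹' {i}) ×ˢ (ψ ⁻¹' {j})) -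
        Q.real ((φ ⁻¹' {i}) ×ˢ (ψ ⁻¹' {j}))| := by
  classical
  obtain ⟨I, rfl⟩ : ∃ I' : Finset (Fin n × Fin m), I = I' := ⟨I.toFinset, by simp⟩
  rw [measureReal_prodMap_preimage_eq_sum J hφ hψ, measureReal_prodMap_preimage_eq_sum Q hφ hψ,
    ← Finset.sum_sub_distrib, ← Fintype.sum_prod_type']
  refine sum_le_half_sum_abs (fun p : Fin n × Fin m => J.real ((φ ⁻¹' {p.1}) ×ˢ (ψ ⁻¹' {p.2})) -
    Q.real ((φ ⁻¹' {p.1}) ×ˢ (ψ ⁻¹' {p.2}))) ?_ I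
  rw [Finset.sum_sub_distrib, ← measureReal_prodMap_preimage_eq_sum J hφ hψ,
    ← measureReal_prodMap_preimage_eq_sum Q hφ hψ]
  simp

/-- The set where `Q` has density less than one with respect to `J`, off the singular part,
realizes the mass which `J` has above `J ∧ Q`. -/
lemma exists_measureReal_sub_eq {α : Type*} [MeasurableSpace α]
    (J Q : Measure α) [IsProbabilityMeasure J] [IsProbabilityMeasure Q] :
    ∃ D, MeasurableSet D ∧
      1 - (J.withDensity (fun p => min 1 (Q.rnDeriv J p))).real Set.univ = J.real D - Q.real D := by
  obtain ⟨N, hN, hsN, hJN⟩ := Q.mutuallySingular_singularPart J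
  have hr := Measure.measurable_rnDeriv Q J
  have hD : MeasurableSet (N ∩ {p | Q.rnDeriv J p < 1}) :=
    hN.inter (measurableSet_lt hr measurable_const)
  set D := N ∩ {p | Q.rnDeriv J p < 1}
  set m := J.withDensity (fun p => min 1 (Q.rnDeriv J p)) with hm
  have hmJ : m ≤ J := by
    conv_rhs => rw [← withDensity_one (μ := J)]
    exact withDensity_mono (ae_of_all _ fun p => min_le_left _ _)
  have : IsFiniteMeasure m := isFiniteMeasure_of_le J hmJ
  have h1 : m.real D = Q.real D := by
    simp only [measureReal_def]
    congr 1
    conv_rhs => rw [Q.haveLebesgueDecomposition_add J, Measure.add_apply,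
      measure_mono_null Set.inter_subset_left hsN, zero_add]
    rw [hm, withDensity_apply _ hD, withDensity_apply _ hD]
    exact setLIntegral_congr_fun hD fun p hp => min_eq_right hp.2.le
  have h2 : m.real Dᶜ = J.real Dᶜ := by
    simp only [measureReal_def]
    congr 1
    rw [hm, withDensity_apply _ hD.compl, ← setLIntegral_one]
    refine setLIntegral_congr_fun_ae hD.compl ?_
    have : ∀ᵐ p ∂J, p ∈ N := by rwa [ae_iff]
    filter_upwards [this] with p hp hpD
    refine min_eq_left (not_lt.1 fun h => hpD ⟨hp, h⟩)
  refine ⟨D, hD, ?_⟩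
  have h3 := measureReal_add_measureReal_compl (μ := m) hD
  have h4 := measureReal_add_measureReal_compl (μ := J) hD
  rw [probReal_univ] at h4
  linarith

lemma restrict_Icc_apply_affine {a : ℝ} (h0 : 0 ≤ a) (h1 : a ≤ 1) {B : Set ℝ} :
    (volume.restrict (Set.Icc (0 : ℝ) 1)) ({u | a < u} ∩ (fun u => (1 - a)⁻¹ * (u - a)) ⁻¹' B) =
      ENNReal.ofReal (1 - a) * (volume.restrict (Set.Icc (0 : ℝ) 1)) B := by
  rw [← restrict_Ioc_eq_restrict_Icc]
  rcases h1.eq_or_lt with rfl | h1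
  · rw [Measure.restrict_apply' measurableSet_Ioc]
    have : ({u : ℝ | 1 < u} ∩ (fun u => (1 - 1 : ℝ)⁻¹ * (u - 1)) ⁻¹' B) ∩ Set.Ioc 0 1 = ∅ := by
      ext u
      simp only [Set.mem_inter_iff, Set.mem_ofPred_eq, Set.mem_Ioc, Set.mem_empty_iff_false,
        iff_false]
      rintro ⟨⟨h, -⟩, -, h'⟩
      linarith
    rw [this]
    simp
  have ha : 0 < 1 - a := by linarith
  rw [Measure.restrict_apply' measurableSet_Ioc, Measure.restrict_apply' measurableSet_Ioc]
  have : ({u : ℝ | a < u} ∩ (fun u => (1 - a)⁻¹ * (u - a)) ⁻¹' B) ∩ Set.Ioc 0 1 =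
      (fun u => u - a) ⁻¹' ((fun u => (1 - a)⁻¹ * u) ⁻¹' (B ∩ Set.Ioc 0 1)) := by
    ext u
    simp only [Set.mem_inter_iff, Set.mem_ofPred_eq, Set.mem_Ioc, Set.mem_preimage,
      inv_mul_le_iff₀ ha, mul_one, inv_pos, ha, mul_pos_iff_of_pos_left, sub_pos]
    constructor
    · rintro ⟨⟨h, h'⟩, h2, h3⟩
      exact ⟨h', h, by linarith⟩
    · rintro ⟨h', h, h3⟩
      exact ⟨⟨h, h'⟩, by linarith, by linarith⟩
  rw [this, show (fun u : ℝ => u - a) = fun u => u + -a from funext fun u => sub_eq_add_neg u a,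
    measure_preimage_add_right, Real.volume_preimage_mul_left (inv_ne_zero ha.ne'), inv_inv,
    abs_of_pos ha]

lemma exists_measurable_map_eq_kernel {S T : Type*} [MeasurableSpace S] [MeasurableSpace T]
    [StandardBorelSpace T] [Nonempty T] (η : Kernel S T) [IsMarkovKernel η] :
    ∃ g : S → ℝ → T, Measurable (Function.uncurry g) ∧
      ∀ x, (volume.restrict (Set.Icc (0 : ℝ) 1)).map (g x) = η x := by
  obtain ⟨f, hf, hfη⟩ := Kernel.exists_measurable_map_eq_unitInterval η
  have hp : Measurable (Set.projIcc (0 : ℝ) 1 zero_le_one) := continuous_projIcc.measurable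
  refine ⟨fun x v => f x (Set.projIcc 0 1 zero_le_one v),
    hf.comp (measurable_fst.prodMk (hp.comp measurable_snd)), fun x => ?_⟩
  have hfx : Measurable (f x) := hf.of_uncurry_left
  rw [← hfη x, ← unitInterval.measurePreserving_coe.map_eq,
    Measure.map_map (f := Subtype.val) (g := fun v => f x (Set.projIcc 0 1 zero_le_one v))
      (hfx.comp hp) measurable_subtype_coe]
  congr 1
  ext u
  simp

/-- Rejection step: keep the second coordinate with probability `a`, and otherwise resample it
from the disintegration of `ρ`, using a single uniform variable. -/
lemma exists_measurable_resample {S T : Type*} [MeasurableSpace S] [MeasurableSpace T]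
    [StandardBorelSpace T] [Nonempty T] (J ρ : Measure (S × T)) [IsFiniteMeasure J]
    [IsFiniteMeasure ρ] {a : S × T → ℝ} (ha : Measurable a) (ha0 : ∀ p, 0 ≤ a p)
    (ha1 : ∀ p, a p ≤ 1)
    (hfst : (J.withDensity (fun p => ENNReal.ofReal (1 - a p))).fst = ρ.fst) :
    ∃ G : (S × T) × ℝ → T, Measurable G ∧ (∀ p u, u ≤ a p → G (p, u) = p.2) ∧
      (J.prod (volume.restrict (Set.Icc (0 : ℝ) 1))).map (fun q => (q.1.1, G q)) =
        J.withDensity (fun p => ENNReal.ofReal (a p)) + ρ := by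
  classical
  obtain ⟨g, hg, hgη⟩ := exists_measurable_map_eq_kernel ρ.condKernel
  let G : (S × T) × ℝ → T := fun q =>
    if q.2 ≤ a q.1 then q.1.2 else g q.1.1 ((1 - a q.1)⁻¹ * (q.2 - a q.1))
  have hG : Measurable G := by
    refine Measurable.ite (measurableSet_le measurable_snd (ha.comp measurable_fst))
      (by fun_prop) (hg.comp (Measurable.prodMk (by fun_prop) (by fun_prop)))
  refine ⟨G, hG, fun p u h => if_pos h, ?_⟩
  set l := volume.restrict (Set.Icc (0 : ℝ) 1) with hl
  ext C hC
  have hmeas : Measurable (fun q : (S × T) × ℝ => (q.1.1, G q)) := by fun_prop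
  rw [Measure.map_apply hmeas hC, Measure.prod_apply (hmeas hC), Measure.add_apply,
    withDensity_apply _ hC, ← lintegral_indicator hC]
  have hsec (x : S) : MeasurableSet (Prod.mk x ⁻¹' C) := measurable_prodMk_left hC
  have key (p : S × T) : l (Prod.mk p ⁻¹' ((fun q : (S × T) × ℝ => (q.1.1, G q)) ⁻¹' C)) =
      C.indicator (fun p => ENNReal.ofReal (a p)) p +
        ENNReal.ofReal (1 - a p) * ρ.condKernel p.1 (Prod.mk p.1 ⁻¹' C) := by
    rw [← measure_inter_add_sdiff _ (measurableSet_Iic (a := a p))]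
    congr 1
    · by_cases hp : p ∈ C
      · have : Prod.mk p ⁻¹' ((fun q : (S × T) × ℝ => (q.1.1, G q)) ⁻¹' C) ∩ Set.Iic (a p) =
            Set.Iic (a p) := by
          refine Set.inter_eq_right.2 fun u hu => ?_
          simpa [G, show u ≤ a p from hu] using hp
        rw [this, Set.indicator_of_mem hp, hl, Measure.restrict_apply measurableSet_Iic,
          show Set.Iic (a p) ∩ Set.Icc 0 1 = Set.Icc 0 (a p) by
            ext u
            simp only [Set.mem_inter_iff, Set.mem_Iic, Set.mem_Icc]
            have := ha1 p
            grind, Real.volume_Icc, sub_zero]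
      · have : Prod.mk p ⁻¹' ((fun q : (S × T) × ℝ => (q.1.1, G q)) ⁻¹' C) ∩ Set.Iic (a p) =
            ∅ := by
          ext u
          simp only [Set.mem_inter_iff, Set.mem_preimage, Set.mem_Iic, Set.mem_empty_iff_false,
            iff_false, not_and]
          intro h hu
          simp [G, hu, hp] at h
        rw [this, Set.indicator_of_notMem hp, measure_empty]
    · have hgp : Measurable (g p.1) := hg.of_uncurry_left
      rw [← hgη p.1, Measure.map_apply hgp (hsec p.1),
        ← restrict_Icc_apply_affine (ha0 p) (ha1 p)]
      congr 1
      ext u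
      simp only [Set.mem_sdiff, Set.mem_preimage, Set.mem_Iic, not_le, Set.mem_inter_iff,
        Set.mem_ofPred_eq]
      constructor
      · rintro ⟨h, hu⟩
        exact ⟨hu, by simpa [G, not_le.2 hu] using h⟩
      · rintro ⟨hu, h⟩
        exact ⟨by simpa [G, not_le.2 hu] using h, hu⟩
  simp_rw [key]
  have hκ : Measurable fun x => ρ.condKernel x (Prod.mk x ⁻¹' C) :=
    Kernel.measurable_kernel_prodMk_left hC
  rw [lintegral_add_left (ha.ennreal_ofReal.indicator hC)]
  congr 1
  conv_rhs => rw [← ρ.disintegrate ρ.condKernel, Measure.compProd_apply hC, ← hfst, Measure.fst,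
    lintegral_map hκ measurable_fst,
    lintegral_withDensity_eq_lintegral_mul (f := fun p => ENNReal.ofReal (1 - a p)) _ (by fun_prop)
      (g := fun p => ρ.condKernel p.1 (Prod.mk p.1 ⁻¹' C)) (hκ.comp measurable_fst)]
  rfl

/-- Two almost disjoint families which coincide off `D` have total variation distance at most
`P D`. -/
lemma half_sum_abs_measureReal_sub_le {Ω ι : Type*} [MeasurableSpace Ω] [Fintype ι]
    (P : Measure Ω) [IsFiniteMeasure P] {E F : ι → Set Ω} {D : Set Ω} (hD : MeasurableSet D)
    (hE : ∀ i, MeasurableSet (E i)) (hF : ∀ i, MeasurableSet (F i))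
    (hEd : Pairwise (Function.onFun (AEDisjoint P) E))
    (hFd : Pairwise (Function.onFun (AEDisjoint P) F))
    (hEF : ∀ i, E i \ D = F i \ D) :
    (1 / 2) * ∑ i, |P.real (E i) - P.real (F i)| ≤ P.real D := by
  have hsum {H : ι → Set Ω} (hH : ∀ i, MeasurableSet (H i))
      (hd : Pairwise (Function.onFun (AEDisjoint P) H)) : ∑ i, P.real (H i ∩ D) ≤ P.real D := by
    rw [← measureReal_biUnion_finset₀
      (fun i _ j _ hij => (hd hij).mono Set.inter_subset_left Set.inter_subset_left)
      (fun i _ => ((hH i).inter hD).nullMeasurableSet)]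
    exact measureReal_mono (Set.iUnion₂_subset fun _ _ => Set.inter_subset_right)
  have hterm (i : ι) : |P.real (E i) - P.real (F i)| ≤ P.real (E i ∩ D) + P.real (F i ∩ D) := by
    have h1 := measureReal_inter_add_sdiff (μ := P) (s := E i) hD
    have h2 := measureReal_inter_add_sdiff (μ := P) (s := F i) hD
    rw [hEF i] at h1
    rw [← h1, ← h2, add_sub_add_right_eq_sub]
    have h3 : 0 ≤ P.real (E i ∩ D) := measureReal_nonneg
    have h4 : 0 ≤ P.real (F i ∩ D) := measureReal_nonneg
    rw [abs_le]
    constructor <;> linarith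
  have := Finset.sum_le_sum fun i (_ : i ∈ Finset.univ) => hterm i
  rw [Finset.sum_add_distrib] at this
  linarith [hsum hE hEd, hsum hF hFd]

/-- Any copy of `Y` independent of `X` differs from `Y` with probability at least the value of
every partition sum in the definition of the β-mixing coefficient. -/
lemma half_sum_partition_le {Ω S T : Type*} [MeasurableSpace Ω] [MeasurableSpace S]
    [MeasurableSpace T] [MeasurableEq T] (P : Measure Ω) [IsProbabilityMeasure P]
    {X : Ω → S} {Y Y' : Ω → T} (hX : Measurable X) (hY : Measurable Y) (hY' : Measurable Y')
    (hind : IndepFun X Y' P) (hlaw : P.map Y' = P.map Y) {n m : ℕ} {As : Fin n → Set Ω}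
    {Bs : Fin m → Set Ω} (hA : ∀ i, MeasurableSet[MeasurableSpace.comap X inferInstance] (As i))
    (hB : ∀ j, MeasurableSet[MeasurableSpace.comap Y inferInstance] (Bs j))
    (hAd : Pairwise (Function.onFun Disjoint As)) (hBd : Pairwise (Function.onFun Disjoint Bs)) :
    (1 / 2) * ∑ i, ∑ j,
      |(P (As i ∩ Bs j)).toReal - (P (As i)).toReal * (P (Bs j)).toReal| ≤
        (P {ω | Y ω ≠ Y' ω}).toReal := by
  choose A hAm hAeq using hA
  choose B hBm hBeq using hB
  obtain rfl : (fun i => X ⁻¹' A i) = As := funext hAeq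
  obtain rfl : (fun j => Y ⁻¹' B j) = Bs := funext hBeq
  have hprod (i : Fin n) (j : Fin m) : (P (X ⁻¹' A i)).toReal * (P (Y ⁻¹' B j)).toReal =
      P.real (X ⁻¹' A i ∩ Y' ⁻¹' B j) := by
    rw [measureReal_def, hind.measure_inter_preimage_eq_mul _ _ (hAm i) (hBm j),
      ENNReal.toReal_mul, ← Measure.map_apply hY (hBm j), ← Measure.map_apply hY' (hBm j), hlaw]
  have hY'd : Pairwise (Function.onFun (AEDisjoint P) fun j => Y' ⁻¹' B j) := by
    intro j k hjk
    change P (Y' ⁻¹' B j ∩ Y' ⁻¹' B k) = 0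
    rw [← Set.preimage_inter, ← Measure.map_apply hY' ((hBm j).inter (hBm k)), hlaw,
      Measure.map_apply hY ((hBm j).inter (hBm k)), Set.preimage_inter, (hBd hjk).inter_eq,
      measure_empty]
  have hpair {C : Fin m → Set Ω} (hC : Pairwise (Function.onFun (AEDisjoint P) C)) :
      Pairwise (Function.onFun (AEDisjoint P)
        fun p : Fin n × Fin m => X ⁻¹' A p.1 ∩ C p.2) := by
    rintro ⟨i, j⟩ ⟨i', j'⟩ hne
    by_cases hi : i = i'
    · have hj : j ≠ j' := fun hj => hne (by rw [hi, hj])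
      exact (hC hj).mono Set.inter_subset_right Set.inter_subset_right
    · exact (hAd hi).aedisjoint.mono Set.inter_subset_left Set.inter_subset_left
  simp_rw [hprod]
  rw [← Fintype.sum_prod_type' (f := fun i j =>
    |(P (X ⁻¹' A i ∩ Y ⁻¹' B j)).toReal - P.real (X ⁻¹' A i ∩ Y' ⁻¹' B j)|)]
  refine half_sum_abs_measureReal_sub_le P (measurableSet_eq_fun hY hY').compl
    (fun p => (hX (hAm p.1)).inter (hY (hBm p.2))) (fun p => (hX (hAm p.1)).inter (hY' (hBm p.2)))
    (hpair fun j k hjk => (hBd hjk).aedisjoint) (hpair hY'd) fun p => ?_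
  ext ω
  simp only [Set.mem_sdiff, Set.mem_inter_iff, Set.mem_preimage, Set.mem_ofPred_eq,
    not_not]
  refine and_congr_left fun h => ?_
  rw [h]

/-- The β-mixing coefficient of `σ(X)` and `σ(Y)` dominates the total variation distance between
the joint law of `(X, Y)` and the product of the marginal laws. -/
lemma measureReal_sub_le_betaMix {Ω S T : Type*} [MeasurableSpace Ω] [MeasurableSpace S]
    [MeasurableSpace T] (P : Measure Ω) [IsProbabilityMeasure P]
    {X : Ω → S} {Y : Ω → T} (hX : Measurable X) (hY : Measurable Y)
    (hbdd : BddAbove {r : ℝ | ∃ (n m : ℕ) (As : Fin n → Set Ω) (Bs : Fin m → Set Ω),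
      (∀ i, MeasurableSet[MeasurableSpace.comap X inferInstance] (As i)) ∧
      (∀ j, MeasurableSet[MeasurableSpace.comap Y inferInstance] (Bs j)) ∧
      Pairwise (Function.onFun Disjoint As) ∧ Pairwise (Function.onFun Disjoint Bs) ∧
      (⋃ i, As i) = Set.univ ∧ (⋃ j, Bs j) = Set.univ ∧
      r = (1 / 2) * ∑ i, ∑ j,
        |(P (As i ∩ Bs j)).toReal - (P (As i)).toReal * (P (Bs j)).toReal|})
    {C : Set (S × T)} (hC : MeasurableSet C) :
    (P.map fun ω => (X ω, Y ω)).real C - ((P.map X).prod (P.map Y)).real C ≤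
      betaMix P (MeasurableSpace.comap X inferInstance)
        (MeasurableSpace.comap Y inferInstance) := by
  have := Measure.isProbabilityMeasure_map (μ := P) (hX.prodMk hY).aemeasurable
  have := Measure.isProbabilityMeasure_map (μ := P) hX.aemeasurable
  have := Measure.isProbabilityMeasure_map (μ := P) hY.aemeasurable
  refine measureReal_sub_le_of_isGridSet _ _ ?_ hC
  rintro _ ⟨n, m, φ, ψ, I, hφ, hψ, rfl⟩
  refine (measureReal_sub_le_half_sum_of_grid _ _ hφ hψ I).trans (le_csSup hbdd ?_)
  refine ⟨n, m, fun i => X ⁻¹' (φ ⁻¹' {i}), fun j => Y ⁻¹' (ψ ⁻¹' {j}),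
    fun i => ⟨_, hφ (measurableSet_singleton i), rfl⟩,
    fun j => ⟨_, hψ (measurableSet_singleton j), rfl⟩,
    fun i j hij => Disjoint.preimage _ (Disjoint.preimage _ (by simpa using hij)),
    fun i j hij => Disjoint.preimage _ (Disjoint.preimage _ (by simpa using hij)),
    by ext; simp, by ext; simp, ?_⟩
  congr 1
  refine Finset.sum_congr rfl fun i _ => Finset.sum_congr rfl fun j _ => ?_
  have hi := hφ (measurableSet_singleton i)
  have hj := hψ (measurableSet_singleton j)
  rw [measureReal_prod_prod, measureReal_def, measureReal_def, measureReal_def,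
    Measure.map_apply (hX.prodMk hY) (hi.prod hj), Measure.map_apply hX hi,
    Measure.map_apply hY hj]
  rfl

/-- Berbee's coupling lemma: if `X, Y` are random variables with values in a Polish
space and `U` is uniform on `[0,1]` independent of `(X,Y)`, then there is `Y*`,
measurable w.r.t. `σ(X) ∨ σ(Y) ∨ σ(U)`, independent of `X`, distributed as `Y`, with
`ℙ(Y ≠ Y*) = β(σ(X),σ(Y))`. -/
theorem stmt_10 {Ω S : Type*} [MeasurableSpace Ω]
    [TopologicalSpace S] [PolishSpace S] [MeasurableSpace S] [BorelSpace S]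
    (P : Measure Ω) [IsProbabilityMeasure P]
    (X Y : Ω → S) (hX : Measurable X) (hY : Measurable Y)
    (U : Ω → ℝ) (hU : Measurable U)
    (hUunif : P.map U = volume.restrict (Set.Icc (0 : ℝ) 1))
    (hUindep : IndepFun U (fun ω => (X ω, Y ω)) P) :
    ∃ Y' : Ω → S,
      Measurable[MeasurableSpace.comap X inferInstance
        ⊔ MeasurableSpace.comap Y inferInstance
        ⊔ MeasurableSpace.comap U inferInstance] Y'
      ∧ IndepFun X Y' P
      ∧ P.map Y' = P.map Y
      ∧ (P {ω | Y ω ≠ Y' ω}).toReal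
          = betaMix P (MeasurableSpace.comap X inferInstance)
              (MeasurableSpace.comap Y inferInstance) := by
  have hne : Nonempty S := (nonempty_of_isProbabilityMeasure P).map X
  have hXY : Measurable fun ω => (X ω, Y ω) := hX.prodMk hY
  have := Measure.isProbabilityMeasure_map (μ := P) hXY.aemeasurable
  have := Measure.isProbabilityMeasure_map (μ := P) hX.aemeasurable
  have := Measure.isProbabilityMeasure_map (μ := P) hY.aemeasurable
  set J := P.map fun ω => (X ω, Y ω) with hJ
  set Q := (P.map X).prod (P.map Y) with hQ
  set l := volume.restrict (Set.Icc (0 : ℝ) 1) with hl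
  have hr := Measure.measurable_rnDeriv Q J
  set a : S × S → ℝ := fun p => (min 1 (Q.rnDeriv J p)).toReal
  have ha : Measurable a := (measurable_const.min hr).ennreal_toReal
  have ha_ofReal (p : S × S) : ENNReal.ofReal (a p) = min 1 (Q.rnDeriv J p) :=
    ENNReal.ofReal_toReal (ne_top_of_le_ne_top ENNReal.one_ne_top (min_le_left _ _))
  have ha0 (p : S × S) : 0 ≤ a p := ENNReal.toReal_nonneg
  have ha1 (p : S × S) : a p ≤ 1 := by
    simpa using ENNReal.toReal_mono ENNReal.one_ne_top (min_le_left 1 (Q.rnDeriv J p))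
  set m := J.withDensity (fun p => ENNReal.ofReal (a p)) with hm
  set k := J.withDensity (fun p => ENNReal.ofReal (1 - a p)) with hk
  have hmQ : m ≤ Q := by
    refine le_trans (withDensity_mono (ae_of_all _ fun p => ?_)) (Q.withDensity_rnDeriv_le J)
    exact (ha_ofReal p).trans_le (min_le_right _ _)
  have : IsFiniteMeasure m := isFiniteMeasure_of_le Q hmQ
  have : IsFiniteMeasure (Q - m) := isFiniteMeasure_of_le Q Measure.sub_le
  have hkm : k + m = J := by
    rw [hk, hm, ← withDensity_add_right _ (by fun_prop)]
    conv_rhs => rw [← withDensity_one (μ := J)]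
    congr 1
    ext p
    simp only [Pi.add_apply, Pi.one_apply]
    rw [← ENNReal.ofReal_add (by linarith [ha1 p]) (ha0 p), sub_add_cancel, ENNReal.ofReal_one]
  have hρm : Q - m + m = Q := Measure.sub_add_cancel_of_le hmQ
  have hfst : k.fst = (Q - m).fst := by
    have h : k.fst + m.fst = (Q - m).fst + m.fst := by
      rw [← Measure.fst_add, ← Measure.fst_add, hkm, hρm, hQ, Measure.fst_prod, hJ,
        Measure.fst_map_prodMk hY]
    ext s hs
    have := congrArg (fun μ : Measure S => μ s) h
    simp only [Measure.add_apply] at this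
    exact (ENNReal.add_left_inj (measure_ne_top _ _)).1 this
  obtain ⟨G, hG, hGeq, hGlaw⟩ := exists_measurable_resample J (Q - m) ha ha0 ha1 hfst
  have hUlaw : P.map (fun ω => ((X ω, Y ω), U ω)) = J.prod l := by
    rw [hUindep.symm.map_prod_eq_prod_map_map hXY.aemeasurable hU.aemeasurable, hUunif]
  have hXYU : Measurable fun ω => ((X ω, Y ω), U ω) := hXY.prodMk hU
  set Y' : Ω → S := fun ω => G ((X ω, Y ω), U ω)
  have hY' : Measurable Y' := hG.comp hXYU
  have hlaw : P.map (fun ω => (X ω, Y' ω)) = Q := by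
    rw [← hρm, add_comm, ← hGlaw, ← hUlaw, Measure.map_map (by fun_prop) hXYU]
    rfl
  have hY'law : P.map Y' = P.map Y := by
    rw [← Measure.snd_map_prodMk (μ := P) hX (Y := Y'), hlaw, hQ, Measure.snd_prod]
  have hind : IndepFun X Y' P := by
    rw [indepFun_iff_map_prod_eq_prod_map_map hX.aemeasurable hY'.aemeasurable, hlaw, hY'law]
  have hle {r : ℝ} (hr : ∃ (n m : ℕ) (As : Fin n → Set Ω) (Bs : Fin m → Set Ω),
      (∀ i, MeasurableSet[MeasurableSpace.comap X inferInstance] (As i)) ∧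
      (∀ j, MeasurableSet[MeasurableSpace.comap Y inferInstance] (Bs j)) ∧
      Pairwise (Function.onFun Disjoint As) ∧ Pairwise (Function.onFun Disjoint Bs) ∧
      (⋃ i, As i) = Set.univ ∧ (⋃ j, Bs j) = Set.univ ∧
      r = (1 / 2) * ∑ i, ∑ j,
        |(P (As i ∩ Bs j)).toReal - (P (As i)).toReal * (P (Bs j)).toReal|) :
      r ≤ (P {ω | Y ω ≠ Y' ω}).toReal := by
    obtain ⟨n, m, As, Bs, hA, hB, hAd, hBd, -, -, rfl⟩ := hr
    exact half_sum_partition_le P hX hY hY' hind hY'law hA hB hAd hBd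
  refine ⟨Y', ?_, hind, hY'law, le_antisymm ?_ ?_⟩
  · refine hG.comp (Measurable.prodMk (Measurable.prodMk ?_ ?_) ?_)
    · exact (comap_measurable X).mono (le_sup_left.trans le_sup_left) le_rfl
    · exact (comap_measurable Y).mono (le_sup_right.trans le_sup_left) le_rfl
    · exact (comap_measurable U).mono le_sup_right le_rfl
  · obtain ⟨D, hD, hDeq⟩ := exists_measureReal_sub_eq J Q
    simp_rw [← ha_ofReal] at hDeq
    refine le_trans ?_ (hDeq.le.trans (measureReal_sub_le_betaMix P hX hY ⟨_, fun _ => hle⟩ hD))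
    have hset : MeasurableSet {q : (S × S) × ℝ | a q.1 < q.2} :=
      measurableSet_lt (ha.comp measurable_fst) measurable_snd
    have h1 : P {ω | Y ω ≠ Y' ω} ≤ k Set.univ := by
      calc P {ω | Y ω ≠ Y' ω}
          ≤ P ((fun ω => ((X ω, Y ω), U ω)) ⁻¹' {q | a q.1 < q.2}) := by
            refine measure_mono fun ω hω => ?_
            by_contra h
            exact hω (hGeq _ _ (not_lt.1 h)).symm
        _ = ∫⁻ p, l (Set.Ioi (a p)) ∂J := by
            rw [← Measure.map_apply hXYU hset, hUlaw, Measure.prod_apply hset]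
            rfl
        _ = k Set.univ := by
            rw [hk, withDensity_apply _ MeasurableSet.univ, setLIntegral_univ]
            refine lintegral_congr fun p => ?_
            rw [hl, Measure.restrict_apply measurableSet_Ioi,
              show Set.Ioi (a p) ∩ Set.Icc 0 1 = Set.Ioc (a p) 1 by
                ext u
                simp only [Set.mem_inter_iff, Set.mem_Ioi, Set.mem_Icc, Set.mem_Ioc]
                have := ha0 p
                grind, Real.volume_Ioc]
    have : IsFiniteMeasure k := isFiniteMeasure_of_le J (hkm ▸ Measure.le_add_right le_rfl)
    have h2 : k.real Set.univ + m.real Set.univ = 1 := by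
      rw [← measureReal_add_apply, hkm, probReal_univ]
    have h3 : (P {ω | Y ω ≠ Y' ω}).toReal ≤ k.real Set.univ :=
      ENNReal.toReal_mono (measure_ne_top _ _) h1
    linarith
  · refine csSup_le ⟨_, 1, 1, fun _ => Set.univ, fun _ => Set.univ, fun _ => MeasurableSet.univ,
      fun _ => MeasurableSet.univ, Subsingleton.pairwise, Subsingleton.pairwise,
      Set.iUnion_const _, Set.iUnion_const _, rfl⟩ fun _ => hle
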